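/- Let D ≥ 2, let H ∈ M_D(ℂ) be Hermitian with tr(H) = 0, and let ρ₀ ∈ M_D(ℂ) be a density matrix with eigenvalues (p_j)_{j=1}^D. Then the expectation of the quantum Fisher information over Haar-random special unitary conjugations satisfies E_{U∼μ(D)} F(Uρ₀U†, H) = (2·tr(H²)/(D²−1))·Σ_{i,j : p_i+p_j ≠ 0} (p_i−p_j)²/(p_i+p_j). -/

import Mathlib

open MeasureTheory Matrix
open scoped ComplexOrder

noncomputable section

namespace Paper

instance matrixMeasurableSpace {m n : Type*} : MeasurableSpace (Matrix m n ℂ) :=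
  (inferInstance : MeasurableSpace (m → n → ℂ))

/-- The quantum Fisher information of a state `ρ` with Hamiltonian `H`. -/
def QFI {n : Type*} [Fintype n] [DecidableEq n] (ρ H : Matrix n n ℂ) : ℝ :=
  if hρ : ρ.IsHermitian then
    2 * ∑ j, ∑ k,
      if hρ.eigenvalues j + hρ.eigenvalues k = 0 then 0
      else ((hρ.eigenvalues j - hρ.eigenvalues k) ^ 2 / (hρ.eigenvalues j + hρ.eigenvalues k)) *
        ‖star (fun i => (hρ.eigenvectorUnitary : Matrix n n ℂ) i j) ⬝ᵥ
          (H *ᵥ fun i => (hρ.eigenvectorUnitary : Matrix n n ℂ) i k)‖ ^ 2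
  else 0

/-! ### The special unitary group as a compact topological group -/

section SpecialUnitary

variable {n : Type*} [Fintype n] [DecidableEq n]

instance matrixBorelSpace : BorelSpace (Matrix n n ℂ) :=
  inferInstanceAs (BorelSpace (n → n → ℂ))

instance specialUnitaryGroupCompactSpace : CompactSpace (specialUnitaryGroup n ℂ) := by
  have hK : IsCompact (Set.univ.pi fun _ : n => Set.univ.pi fun _ : n =>
      Metric.closedBall (0 : ℂ) 1) :=
    isCompact_univ_pi fun _ => isCompact_univ_pi fun _ => isCompact_closedBall 0 1
  have hC : IsClosed {U : Matrix n n ℂ | U * star U = 1 ∧ U.det = 1} :=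
    (isClosed_eq (by fun_prop) continuous_const).inter (isClosed_eq (by fun_prop) continuous_const)
  have hS : {U : Matrix n n ℂ | U * star U = 1 ∧ U.det = 1} =
      (specialUnitaryGroup n ℂ : Set (Matrix n n ℂ)) := by
    ext U
    simp [mem_specialUnitaryGroup_iff, mem_unitaryGroup_iff]
  rw [hS] at hC
  refine isCompact_iff_compactSpace.mp (IsCompact.of_isClosed_subset hK hC fun U hU => ?_)
  exact fun i _ j _ => mem_closedBall_zero_iff.mpr
    (entry_norm_bound_of_unitary (specialUnitaryGroup_le_unitaryGroup hU) i j)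

/-- Every unitary matrix is a special unitary matrix up to a phase. -/
theorem exists_smul_mem_specialUnitaryGroup [Nonempty n] {V : Matrix n n ℂ}
    (hV : V ∈ unitaryGroup n ℂ) :
    ∃ z : ℂ, z * star z = 1 ∧ z • V ∈ specialUnitaryGroup n ℂ := by
  have hdet : ‖V.det‖ = 1 := by
    have h := det_of_mem_unitary hV
    rw [Unitary.mem_iff_self_mul_star] at h
    have h' : V.det * (starRingEnd ℂ) V.det = 1 := h
    rw [Complex.mul_conj'] at h'
    have : ‖V.det‖ ^ 2 = 1 := by exact_mod_cast h'
    nlinarith [norm_nonneg V.det]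
  obtain ⟨z, hz⟩ := IsAlgClosed.exists_pow_nat_eq (V.det)⁻¹ (Fintype.card_pos (α := n))
  have hzn : ‖z‖ = 1 := by
    have : ‖z‖ ^ Fintype.card n = 1 := by rw [← norm_pow, hz, norm_inv, hdet, inv_one]
    exact (pow_eq_one_iff_of_nonneg (norm_nonneg z) Fintype.card_ne_zero).mp this
  have hzz : z * star z = 1 := by
    have := Complex.mul_conj' z
    rw [hzn] at this
    simpa using this
  refine ⟨z, hzz, mem_specialUnitaryGroup_iff.mpr ⟨?_, ?_⟩⟩
  · rw [mem_unitaryGroup_iff] at hV ⊢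
    rw [star_smul, smul_mul_smul_comm, hzz, hV, one_smul]
  · have : V.det ≠ 0 := by
      rw [← norm_ne_zero_iff, hdet]
      exact one_ne_zero
    rw [det_smul, hz, inv_mul_cancel₀ this]

theorem integral_conj_unitary [Nonempty n] (μ : Measure (specialUnitaryGroup n ℂ))
    [μ.IsMulLeftInvariant] (A : Matrix n n ℂ) (f : Matrix n n ℂ → ℝ) {V : Matrix n n ℂ}
    (hV : V ∈ unitaryGroup n ℂ) :
    ∫ U, f (V * (U.1 * A * star U.1) * star V) ∂μ = ∫ U, f (U.1 * A * star U.1) ∂μ := by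
  obtain ⟨z, hz, hzV⟩ := exists_smul_mem_specialUnitaryGroup hV
  rw [← integral_mul_left_eq_self (fun U : specialUnitaryGroup n ℂ => f (U.1 * A * star U.1))
    ⟨z • V, hzV⟩]
  refine integral_congr_ae (.of_forall fun U => congrArg f ?_)
  simp only [Submonoid.coe_mul, star_mul, star_smul, smul_mul_assoc, mul_smul_comm, smul_smul]
  rw [mul_comm (star z), hz, one_smul]
  simp only [mul_assoc]

theorem integrable_of_continuous_conj (μ : Measure (specialUnitaryGroup n ℂ))
    [IsFiniteMeasure μ] (A : Matrix n n ℂ) {f : Matrix n n ℂ → ℝ} (hf : Continuous f) :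
    Integrable (fun U : specialUnitaryGroup n ℂ => f (U.1 * A * star U.1)) μ := by
  refine Continuous.integrable_of_hasCompactSupport (hf.comp ?_)
    (HasCompactSupport.of_compactSpace _)
  fun_prop

end SpecialUnitary

/-! ### The second moment of a Haar-random conjugate -/

section SecondMoment

variable {n : Type*} [Fintype n] [DecidableEq n]

theorem permMatrix_mem_unitaryGroup (σ : Equiv.Perm n) :
    σ.permMatrix ℂ ∈ unitaryGroup n ℂ := by
  rw [mem_unitaryGroup_iff, star_eq_conjTranspose, conjTranspose_permMatrix, ← permMatrix_mul]
  simp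

theorem permMatrix_conj_apply (σ : Equiv.Perm n) (M : Matrix n n ℂ) (a b : n) :
    (σ.permMatrix ℂ * M * star (σ.permMatrix ℂ)) a b = M (σ a) (σ b) := by
  rw [star_eq_conjTranspose, conjTranspose_permMatrix]
  simp [PEquiv.toMatrix_toPEquiv_mul, PEquiv.mul_toMatrix_toPEquiv, Equiv.Perm.inv_def]

theorem exists_perm_apply_eq {m : Type*} [DecidableEq m] {i j a b : m} (hij : i ≠ j) (hab : a ≠ b) :
    ∃ σ : Equiv.Perm m, σ i = a ∧ σ j = b := by
  refine ⟨Equiv.swap (Equiv.swap i a j) b * Equiv.swap i a, ?_, by simp⟩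
  rw [Equiv.Perm.mul_apply, Equiv.swap_apply_left]
  refine Equiv.swap_apply_of_ne_of_ne (fun h => hij ?_) hab
  exact (Equiv.swap i a).injective ((Equiv.swap_apply_left i a).trans h)

theorem isHermitian_eq_conj {H : Matrix n n ℂ} (hH : H.IsHermitian) :
    H = (hH.eigenvectorUnitary : Matrix n n ℂ) * diagonal (fun i => (hH.eigenvalues i : ℂ)) *
      star (hH.eigenvectorUnitary : Matrix n n ℂ) := by
  conv_lhs => rw [hH.spectral_theorem]
  rw [Unitary.conjStarAlgAut_apply]
  rfl

theorem norm_sum_mul_sq {m : Type*} [Fintype m] (h : m → ℝ) (z : m → ℂ) :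
    ‖∑ a, (h a : ℂ) * z a‖ ^ 2 = ∑ a, ∑ b, h a * h b * (star (z a) * z b).re := by
  have h1 : ((‖∑ a, (h a : ℂ) * z a‖ ^ 2 : ℝ) : ℂ) =
      ∑ a, ∑ b, ((h a * h b : ℝ) : ℂ) * (star (z a) * z b) := by
    push_cast
    rw [← Complex.conj_mul', map_sum, Finset.sum_mul_sum]
    refine Finset.sum_congr rfl fun a _ => Finset.sum_congr rfl fun b _ => ?_
    simp only [map_mul, Complex.conj_ofReal, Complex.star_def]
    ring
  have h2 := congrArg Complex.re h1
  rw [Complex.ofReal_re] at h2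
  rw [h2]
  simp only [Complex.re_sum, Complex.re_ofReal_mul]

theorem sum_norm_sq_eq_trace {m : Type*} [Fintype m] (M : Matrix m m ℂ) :
    ∑ a, ∑ b, ‖M a b‖ ^ 2 = (trace (M * star M)).re := by
  simp only [trace, diag_apply, mul_apply, star_apply, Complex.re_sum]
  refine Finset.sum_congr rfl fun a _ => Finset.sum_congr rfl fun b _ => ?_
  rw [Complex.star_def, Complex.mul_conj']
  norm_cast

variable (μ : Measure (specialUnitaryGroup n ℂ)) (A : Matrix n n ℂ)

/-- The correlations of the diagonal entries of a Haar-random conjugate of `A`. -/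
def diagCorr (a b : n) : ℝ :=
  ∫ U, (star ((U.1 * A * star U.1) a a) * (U.1 * A * star U.1) b b).re ∂μ

theorem sum_diagCorr_eq_zero [IsFiniteMeasure μ] (hA : A.trace = 0) (a : n) :
    ∑ b, diagCorr μ A a b = 0 := by
  have hInt (b : n) := integrable_of_continuous_conj μ A
    (f := fun M => (star (M a a) * M b b).re) (by fun_prop)
  simp only [diagCorr]
  rw [← integral_finsetSum _ fun b _ => hInt b]
  refine integral_eq_zero_of_ae (.of_forall fun U => ?_)
  have htr : ∑ b, (U.1 * A * star U.1) b b = 0 := by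
    change trace (U.1 * A * star U.1) = 0
    rw [trace_mul_cycle, mem_unitaryGroup_iff'.mp (specialUnitaryGroup_le_unitaryGroup U.2),
      one_mul, hA]
  simp only [← Complex.re_sum, ← Finset.mul_sum]
  rw [htr]
  simp

variable [μ.IsMulLeftInvariant]

theorem diagCorr_perm [Nonempty n] (σ : Equiv.Perm n) (a b : n) :
    diagCorr μ A (σ a) (σ b) = diagCorr μ A a b := by
  rw [diagCorr, diagCorr, ← integral_conj_unitary μ A (fun M => (star (M a a) * M b b).re)
    (permMatrix_mem_unitaryGroup σ)]
  simp only [permMatrix_conj_apply]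

theorem diagCorr_eq {i j : n} (hij : i ≠ j) (a b : n) :
    diagCorr μ A a b =
      diagCorr μ A i j + if a = b then diagCorr μ A i i - diagCorr μ A i j else 0 := by
  have : Nonempty n := ⟨i⟩
  split_ifs with h
  · subst h
    have := diagCorr_perm μ A (Equiv.swap i a) i i
    rw [Equiv.swap_apply_left] at this
    linarith
  · obtain ⟨σ, rfl, rfl⟩ := exists_perm_apply_eq hij h
    rw [diagCorr_perm, add_zero]

variable [IsProbabilityMeasure μ]

theorem integral_norm_trace_sq_eq_diagCorr {i j : n} (hij : i ≠ j) {H : Matrix n n ℂ}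
    (hH : H.IsHermitian) (htrH : H.trace = 0) :
    ∫ U, ‖trace (H * (U.1 * A * star U.1))‖ ^ 2 ∂μ =
      (diagCorr μ A i i - diagCorr μ A i j) * (trace (H * H)).re := by
  have : Nonempty n := ⟨i⟩
  have hV := hH.eigenvectorUnitary.2
  have hVV := mem_unitaryGroup_iff'.mp hV
  have hdec := isHermitian_eq_conj hH
  set V := (hH.eigenvectorUnitary : Matrix n n ℂ)
  set h := hH.eigenvalues
  have hsum : ∑ a, h a = 0 := by
    have := hH.trace_eq_sum_eigenvalues
    rw [htrH] at this
    simpa [← Complex.ofReal_sum] using this.symm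
  have hsq : (trace (H * H)).re = ∑ a, h a ^ 2 := by
    have : trace (H * H) = trace (diagonal (fun i => (h i : ℂ)) * diagonal fun i => (h i : ℂ)) := by
      conv_lhs => rw [hdec]
      rw [show ∀ d : Matrix n n ℂ, V * d * star V * (V * d * star V) =
        V * d * (star V * V) * d * star V by intro d; simp only [mul_assoc], hVV,
        trace_mul_comm, mul_one, mul_assoc, ← mul_assoc, hVV, one_mul]
    rw [this, diagonal_mul_diagonal, trace_diagonal, Complex.re_sum]
    simp [sq]
  have hkey (U : specialUnitaryGroup n ℂ) : ‖trace (H * (V * (U.1 * A * star U.1) * star V))‖ ^ 2 =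
      ∑ a, ∑ b, h a * h b *
        (star ((U.1 * A * star U.1) a a) * (U.1 * A * star U.1) b b).re := by
    rw [← norm_sum_mul_sq]
    congr 2
    conv_lhs => rw [hdec]
    rw [show ∀ d M : Matrix n n ℂ, V * d * star V * (V * M * star V) =
        V * d * (star V * V) * M * star V by intro d M; simp only [mul_assoc], hVV,
        trace_mul_comm, mul_one, mul_assoc, ← mul_assoc, hVV, one_mul]
    simp [trace, diagonal_mul]
  have hInt (a b : n) := (integrable_of_continuous_conj μ A
    (f := fun M => (star (M a a) * M b b).re) (by fun_prop)).const_mul (h a * h b)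
  rw [← integral_conj_unitary μ A (fun M => ‖trace (H * M)‖ ^ 2) hV]
  simp only [hkey]
  rw [integral_finsetSum _ fun a _ => integrable_finsetSum _ fun b _ => hInt a b]
  simp_rw [integral_finsetSum _ fun b _ => hInt _ b, integral_const_mul]
  change ∑ a, ∑ b, h a * h b * diagCorr μ A a b = _
  have hcorr := diagCorr_eq μ A hij
  generalize diagCorr μ A i j = β, diagCorr μ A i i = α at hcorr ⊢
  simp_rw [hcorr, mul_add, Finset.sum_add_distrib, ← Finset.sum_mul, mul_ite,
    mul_zero, Finset.sum_ite_eq, Finset.mem_univ, if_true, ← Finset.sum_mul_sum, hsum, hsq,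
    Finset.mul_sum, zero_mul, zero_add]
  exact Finset.sum_congr rfl fun a _ => by ring

theorem integral_norm_entry_sq_add {i j a b : n} (hij : i ≠ j) (hab : a ≠ b) :
    ∫ U, ‖(U.1 * A * star U.1) a b‖ ^ 2 ∂μ + ∫ U, ‖(U.1 * A * star U.1) b a‖ ^ 2 ∂μ =
      2 * (diagCorr μ A i i - diagCorr μ A i j) := by
  have hX := integral_norm_trace_sq_eq_diagCorr μ A hij
    (H := single a b 1 + single b a 1) (by
      rw [IsHermitian, conjTranspose_add, conjTranspose_single, conjTranspose_single, star_one,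
        add_comm])
    (by simp [trace_add, trace_single_eq_of_ne, hab, hab.symm])
  have hY := integral_norm_trace_sq_eq_diagCorr μ A hij
    (H := single a b Complex.I + single b a (-Complex.I)) (by
      rw [IsHermitian, conjTranspose_add, conjTranspose_single, conjTranspose_single, star_neg,
        Complex.star_def, Complex.conj_I, neg_neg, add_comm])
    (by simp [trace_add, trace_single_eq_of_ne, hab, hab.symm])
  have hI {f : Matrix n n ℂ → ℝ} (hf : Continuous f) := integrable_of_continuous_conj μ A hf
  have hadd : ∫ U, ‖trace ((single a b 1 + single b a 1) * (U.1 * A * star U.1))‖ ^ 2 ∂μ +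
      ∫ U, ‖trace ((single a b Complex.I + single b a (-Complex.I)) *
        (U.1 * A * star U.1))‖ ^ 2 ∂μ =
      2 * (∫ U, ‖(U.1 * A * star U.1) a b‖ ^ 2 ∂μ + ∫ U, ‖(U.1 * A * star U.1) b a‖ ^ 2 ∂μ) := by
    rw [← integral_add (hI (f := fun M => ‖trace ((single a b 1 + single b a 1) * M)‖ ^ 2)
        (by fun_prop)) (hI (f := fun M =>
          ‖trace ((single a b Complex.I + single b a (-Complex.I)) * M)‖ ^ 2) (by fun_prop)),
      ← integral_add (hI (f := fun M => ‖M a b‖ ^ 2) (by fun_prop))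
        (hI (f := fun M => ‖M b a‖ ^ 2) (by fun_prop)), ← integral_const_mul]
    refine integral_congr_ae (.of_forall fun U => ?_)
    simp only [add_mul, trace_add, trace_single_mul, smul_eq_mul, one_mul, neg_mul]
    generalize (U.1 * A * star U.1) a b = x
    generalize (U.1 * A * star U.1) b a = y
    simp only [Complex.sq_norm, Complex.normSq_apply, Complex.add_re, Complex.add_im,
      Complex.neg_re, Complex.neg_im, Complex.mul_re, Complex.mul_im, Complex.I_re, Complex.I_im]
    ring
  rw [hX, hY] at hadd
  simp [add_mul, mul_add, trace_add, hab, hab.symm] at hadd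
  linarith

/-- The second moment of the overlap of `H` with a Haar-random conjugate of `A`. -/
theorem integral_norm_trace_sq (hn : 2 ≤ Fintype.card n) {H : Matrix n n ℂ}
    (hH : H.IsHermitian) (htrH : H.trace = 0) (hA : A.trace = 0) :
    ∫ U, ‖trace (H * (U.1 * A * star U.1))‖ ^ 2 ∂μ =
      (trace (A * star A)).re * (trace (H * H)).re / ((Fintype.card n : ℝ) ^ 2 - 1) := by
  obtain ⟨i, j, hij⟩ := Fintype.exists_pair_of_one_lt_card (show 1 < Fintype.card n by lia)
  have hn' : (2 : ℝ) ≤ Fintype.card n := by exact_mod_cast hn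
  rw [integral_norm_trace_sq_eq_diagCorr μ A hij hH htrH]
  set c := diagCorr μ A i i - diagCorr μ A i j with hc
  have hzero : c + Fintype.card n * diagCorr μ A i j = 0 := by
    have h := sum_diagCorr_eq_zero μ A hA i
    rw [Finset.sum_congr rfl fun b _ => diagCorr_eq μ A hij i b] at h
    simp only [Finset.sum_add_distrib, Finset.sum_const, Finset.card_univ, nsmul_eq_mul,
      Finset.sum_ite_eq, Finset.mem_univ, if_true] at h
    linarith
  have hentry (a b : n) : ∫ U, ‖(U.1 * A * star U.1) a b‖ ^ 2 ∂μ +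
      ∫ U, ‖(U.1 * A * star U.1) b a‖ ^ 2 ∂μ =
        2 * c + if a = b then 2 * diagCorr μ A i j else 0 := by
    split_ifs with hab
    · subst hab
      have h := diagCorr_eq μ A hij a a
      rw [if_pos rfl, diagCorr] at h
      have h' : ∫ U, ‖(U.1 * A * star U.1) a a‖ ^ 2 ∂μ =
          ∫ U, (star ((U.1 * A * star U.1) a a) * (U.1 * A * star U.1) a a).re ∂μ := by
        refine integral_congr_ae (.of_forall fun U => ?_)
        simp only [Complex.star_def, Complex.conj_mul']
        norm_cast
      rw [h', h]
      ring
    · rw [add_zero, hc, integral_norm_entry_sq_add μ A hij hab]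
  have hInt (a b : n) := integrable_of_continuous_conj μ A
    (f := fun M => ‖M a b‖ ^ 2) (by fun_prop)
  have htotal : ∑ a, ∑ b, ∫ U, ‖(U.1 * A * star U.1) a b‖ ^ 2 ∂μ = (trace (A * star A)).re := by
    simp_rw [← integral_finsetSum _ fun b _ => hInt _ b]
    rw [← integral_finsetSum _ fun a _ => integrable_finsetSum _ fun b _ => hInt a b]
    have hU (U : specialUnitaryGroup n ℂ) :
        ∑ a, ∑ b, ‖(U.1 * A * star U.1) a b‖ ^ 2 = (trace (A * star A)).re := by
      have hU' := mem_unitaryGroup_iff'.mp (specialUnitaryGroup_le_unitaryGroup U.2)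
      rw [sum_norm_sq_eq_trace, star_mul, star_mul, star_star,
        show U.1 * A * star U.1 * (U.1 * (star A * star U.1)) =
          U.1 * A * (star U.1 * U.1) * star A * star U.1 by simp only [mul_assoc], hU',
        trace_mul_comm, mul_one, mul_assoc, ← mul_assoc, hU', one_mul]
    simp [hU]
  have hdouble : 2 * (trace (A * star A)).re =
      ∑ a : n, ∑ b : n, (2 * c + if a = b then 2 * diagCorr μ A i j else 0) := by
    simp_rw [← hentry, Finset.sum_add_distrib]
    rw [Finset.sum_comm (f := fun a b => ∫ U, ‖(U.1 * A * star U.1) b a‖ ^ 2 ∂μ), htotal]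
    ring
  simp only [Finset.sum_add_distrib, Finset.sum_const, Finset.card_univ, nsmul_eq_mul,
    Finset.sum_ite_eq, Finset.mem_univ, if_true] at hdouble
  have hne : (Fintype.card n : ℝ) ^ 2 - 1 ≠ 0 := by nlinarith
  rw [eq_div_iff hne]
  linear_combination (-(trace (H * H)).re / 2) * hdouble + (-(trace (H * H)).re) * hzero

end SecondMoment

/-! ### Independence of the quantum Fisher information of the eigenbasis -/

section Eigenbasis

variable {n : Type*} [Fintype n] [DecidableEq n]

/-- Conjugation by a matrix intertwining two real diagonal matrices preserves the norm weighted by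
any function of the diagonal entries. -/
theorem sum_weighted_norm_sq_conj (w : ℝ → ℝ → ℝ) {p q : n → ℝ} {S : Matrix n n ℂ}
    (hS : S ∈ unitaryGroup n ℂ) (hpq : ∀ j k, S j k ≠ 0 → q j = p k) (N : Matrix n n ℂ) :
    ∑ j, ∑ k, w (p j) (p k) * ‖(star S * N * S) j k‖ ^ 2 =
      ∑ j, ∑ k, w (q j) (q k) * ‖N j k‖ ^ 2 := by
  have hsum (r : n → ℝ) (M : Matrix n n ℂ) :
      ((∑ j, ∑ k, w (r j) (r k) * ‖M j k‖ ^ 2 : ℝ) : ℂ) =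
        trace (of (fun j k => (w (r j) (r k) : ℂ) * M j k) * star M) := by
    simp only [trace, diag_apply, mul_apply, star_apply, of_apply, mul_assoc, Complex.star_def,
      Complex.mul_conj']
    norm_cast
  have hK : of (fun j k => (w (p j) (p k) : ℂ) * (star S * N * S) j k) =
      star S * of (fun j k => (w (q j) (q k) : ℂ) * N j k) * S := by
    ext j k
    simp only [of_apply, mul_apply, star_apply, Finset.mul_sum, Finset.sum_mul]
    refine Finset.sum_congr rfl fun b _ => Finset.sum_congr rfl fun a _ => ?_
    by_cases hb : S b k = 0
    · simp [hb]
    by_cases ha : S a j = 0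
    · simp [ha]
    rw [hpq _ _ hb, hpq _ _ ha]
    ring
  have hSS := mem_unitaryGroup_iff.mp hS
  apply Complex.ofReal_injective
  rw [hsum, hsum, hK, star_mul, star_mul, star_star]
  generalize of (fun j k => (w (q j) (q k) : ℂ) * N j k) = K
  rw [show star S * K * S * (star S * (star N * S)) = star S * K * (S * star S) * star N * S by
    simp only [mul_assoc], hSS, trace_mul_comm, mul_one, mul_assoc, ← mul_assoc, hSS, one_mul]

theorem star_col_dotProduct_mulVec {m : Type*} [Fintype m] (V H : Matrix m m ℂ)
    (j k : m) :
    star (fun i => V i j) ⬝ᵥ (H *ᵥ fun i => V i k) = (star V * H * V) j k := by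
  rw [mul_assoc, mul_apply]
  simp [dotProduct, mulVec, mul_apply, star_apply]

/-- The quantum Fisher information can be computed in any orthonormal eigenbasis. -/
theorem QFI_eq_of_eigenbasis (H : Matrix n n ℂ) {V : Matrix n n ℂ} (hV : V ∈ unitaryGroup n ℂ)
    (p : n → ℝ) :
    QFI (V * diagonal (fun i => (p i : ℂ)) * star V) H =
      2 * ∑ j, ∑ k, (if p j + p k = 0 then 0 else (p j - p k) ^ 2 / (p j + p k)) *
        ‖(star V * H * V) j k‖ ^ 2 := by
  have hρ : (V * diagonal (fun i => (p i : ℂ)) * star V).IsHermitian := by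
    rw [star_eq_conjTranspose]
    refine isHermitian_mul_mul_conjTranspose V (isHermitian_diagonal_of_self_adjoint _ ?_)
    ext i
    simp
  rw [QFI, dif_pos hρ]
  have hdec := isHermitian_eq_conj hρ
  have hW := hρ.eigenvectorUnitary.2
  set W := (hρ.eigenvectorUnitary : Matrix n n ℂ)
  set q := hρ.eigenvalues
  simp only [star_col_dotProduct_mulVec]
  congr 1
  have hWW := mem_unitaryGroup_iff.mp hW
  have hS : star W * V ∈ unitaryGroup n ℂ := mul_mem (Unitary.star_mem hW) hV
  have hpq (j k : n) (hjk : (star W * V) j k ≠ 0) : q j = p k := by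
    have h : diagonal (fun i => (q i : ℂ)) * (star W * V) =
        star W * V * diagonal (fun i => (p i : ℂ)) := by
      calc diagonal (fun i => (q i : ℂ)) * (star W * V)
          = star W * W * diagonal (fun i => (q i : ℂ)) * (star W * V) := by
            rw [mem_unitaryGroup_iff'.mp hW, one_mul]
        _ = star W * (W * diagonal (fun i => (q i : ℂ)) * star W) * V := by simp only [mul_assoc]
        _ = star W * (V * diagonal (fun i => (p i : ℂ)) * star V) * V := by rw [← hdec]
        _ = star W * V * diagonal (fun i => (p i : ℂ)) * (star V * V) := by simp only [mul_assoc]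
        _ = _ := by rw [mem_unitaryGroup_iff'.mp hV, mul_one]
    have h' := congrFun (congrFun h j) k
    rw [diagonal_mul, mul_diagonal, mul_comm] at h'
    exact_mod_cast mul_left_cancel₀ hjk h'
  have : star (star W * V) * (star W * H * W) * (star W * V) = star V * H * V := by
    rw [star_mul, star_star, show star V * W * (star W * H * W) * (star W * V) =
      star V * (W * star W) * H * (W * star W) * V by simp only [mul_assoc], hWW, mul_one, mul_one]
  have hsum := sum_weighted_norm_sq_conj
    (fun x y => if x + y = 0 then 0 else (x - y) ^ 2 / (x + y)) hS hpq (star W * H * W)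
  rw [this] at hsum
  simp only [ite_mul, zero_mul] at hsum ⊢
  exact hsum.symm

end Eigenbasis

/-- the Haar average of the QFI over an isospectral ensemble:
`E_{U∼μ(D)} F(Uρ₀U†, H) = (2·tr(H²)/(D²−1))·Σ_{i,j : p_i+p_j ≠ 0} (p_i−p_j)²/(p_i+p_j)`. -/
theorem average_qfi_isospectral (D : ℕ) (hD : 2 ≤ D)
    (H : Matrix (Fin D) (Fin D) ℂ) (hH : H.IsHermitian) (htrH : H.trace = 0)
    (ρ₀ : Matrix (Fin D) (Fin D) ℂ) (hρ : ρ₀.PosSemidef) (htrρ : ρ₀.trace = 1)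
    (μ : Measure (Matrix.specialUnitaryGroup (Fin D) ℂ))
    [IsProbabilityMeasure μ] [μ.IsMulLeftInvariant] :
    ∫ U, QFI (U.1 * ρ₀ * star U.1) H ∂μ =
      (2 * (Matrix.trace (H * H)).re / ((D : ℝ) ^ 2 - 1)) *
        ∑ i, ∑ j,
          (if hρ.1.eigenvalues i + hρ.1.eigenvalues j = 0 then 0
           else (hρ.1.eigenvalues i - hρ.1.eigenvalues j) ^ 2 /
             (hρ.1.eigenvalues i + hρ.1.eigenvalues j)) := by
  have hDn : 2 ≤ Fintype.card (Fin D) := by simpa using hD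
  have hdec := isHermitian_eq_conj hρ.1
  have hW := hρ.1.eigenvectorUnitary.2
  set W := (hρ.1.eigenvectorUnitary : Matrix (Fin D) (Fin D) ℂ)
  set p := hρ.1.eigenvalues
  have hWW := mem_unitaryGroup_iff'.mp hW
  let A (j k : Fin D) : Matrix (Fin D) (Fin D) ℂ := W * single k j 1 * star W
  have hentry (U : specialUnitaryGroup (Fin D) ℂ) (j k : Fin D) :
      (star (U.1 * W) * H * (U.1 * W)) j k = trace (H * (U.1 * A j k * star U.1)) := by
    rw [show H * (U.1 * A j k * star U.1) = H * (U.1 * W) * single k j 1 * star (U.1 * W) by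
      simp only [A, star_mul, mul_assoc], trace_mul_comm, ← mul_assoc,
      ← mul_assoc, trace_mul_single]
    simp [mul_assoc]
  have hQ (U : specialUnitaryGroup (Fin D) ℂ) : QFI (U.1 * ρ₀ * star U.1) H =
      2 * ∑ j, ∑ k, (if p j + p k = 0 then 0 else (p j - p k) ^ 2 / (p j + p k)) *
        ‖trace (H * (U.1 * A j k * star U.1))‖ ^ 2 := by
    have hUW : U.1 * W ∈ unitaryGroup (Fin D) ℂ :=
      mul_mem (specialUnitaryGroup_le_unitaryGroup U.2) hW
    rw [show U.1 * ρ₀ * star U.1 =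
      U.1 * W * diagonal (fun i => (p i : ℂ)) * star (U.1 * W) by
        rw [hdec, star_mul]; simp only [mul_assoc], QFI_eq_of_eigenbasis H hUW]
    simp only [hentry]
  have hmean (j k : Fin D) :
      (if p j + p k = 0 then 0 else (p j - p k) ^ 2 / (p j + p k)) *
        ∫ U, ‖trace (H * (U.1 * A j k * star U.1))‖ ^ 2 ∂μ =
      (if p j + p k = 0 then 0 else (p j - p k) ^ 2 / (p j + p k)) *
        ((trace (H * H)).re / ((D : ℝ) ^ 2 - 1)) := by
    obtain rfl | hjk := eq_or_ne j k
    · simp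
    have htr : (A j k).trace = 0 := by
      simp only [A]
      rw [trace_mul_cycle, hWW, one_mul, trace_single_eq_of_ne _ _ _ hjk.symm]
    have hnorm : trace (A j k * star (A j k)) = 1 := by
      simp only [A, star_mul, star_star]
      rw [show W * single k j (1 : ℂ) * star W * (W * (star (single k j 1) * star W)) =
        W * single k j 1 * (star W * W) * star (single k j 1) * star W by simp only [mul_assoc],
        hWW, trace_mul_comm, mul_one, mul_assoc, ← mul_assoc, hWW, one_mul,
        star_eq_conjTranspose, conjTranspose_single, star_one, single_mul_single_same, one_mul,
        trace_single_eq_same]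
    rw [integral_norm_trace_sq μ (A j k) hDn hH htrH htr, hnorm]
    simp
  have hInt (j k : Fin D) := (integrable_of_continuous_conj μ (A j k)
    (f := fun M => ‖trace (H * M)‖ ^ 2) (by fun_prop)).const_mul
      (if p j + p k = 0 then 0 else (p j - p k) ^ 2 / (p j + p k))
  simp only [hQ]
  rw [integral_const_mul,
    integral_finsetSum _ fun j _ => integrable_finsetSum _ fun k _ => hInt j k]
  simp_rw [integral_finsetSum _ fun k _ => hInt _ k, integral_const_mul, hmean, ← Finset.sum_mul]
  ring

end Paper
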